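/- For every A ≥ 1 there exist constants C > 0 and τ₀ ∈ (0,1), depending only on A, such that for all τ ∈ (0, τ₀), every P₁ ∈ S³, and every t₁ with A⁻¹ τ^{−1/2} < t₁ < A τ^{−1/2}, the derivative at s = t₁ of the function s ↦ ∫_{S³} ((1 − ⟨x,P₁⟩)/(1 + ⟨x,P₁⟩)) δ_{P₁,s}(x)^{3−τ} dx satisfies | (d/ds)|_{s=t₁} ∫_{S³} ((1 − ⟨x,P₁⟩)/(1 + ⟨x,P₁⟩)) δ_{P₁,s}^{3−τ} dx + 12π²/t₁³ | ≤ C τ^{5/2} |log τ|. -/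

import Mathlib

open MeasureTheory Real Set Metric
open scoped RealInnerProductSpace

noncomputable section

/-- The unit sphere `S³ ⊂ ℝ⁴`. -/
abbrev S3 : Set (EuclideanSpace ℝ (Fin 4)) := Metric.sphere (0 : EuclideanSpace ℝ (Fin 4)) 1

/-- The surface (Riemannian volume) measure on `S³`, realized as the measure on the unit
sphere induced by the Lebesgue measure of `ℝ⁴` (so that the total mass is `2π²`). -/
def μS3 : Measure S3 := (volume : Measure (EuclideanSpace ℝ (Fin 4))).toSphere

/-- The standard bubble `δ_{P,t}(x) = t / (1 + ((t²−1)/2)(1 − ⟨x,P⟩))` on `S³`. -/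
def bubble (P : S3) (t : ℝ) (x : S3) : ℝ :=
  t / (1 + ((t ^ 2 - 1) / 2) *
    (1 - ⟪(x : EuclideanSpace ℝ (Fin 4)), (P : EuclideanSpace ℝ (Fin 4))⟫))

/-- The geodesic distance on the unit sphere: `d(P,Q) = arccos ⟨P,Q⟩`. -/
def geoDist (P Q : S3) : ℝ :=
  Real.arccos ⟪(P : EuclideanSpace ℝ (Fin 4)), (Q : EuclideanSpace ℝ (Fin 4))⟫

/-- The Green's function `G_P(Q) = 1/(1 − ⟨P,Q⟩) = 1/(1 − cos d(P,Q))`. -/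
def green (P Q : S3) : ℝ :=
  1 / (1 - ⟪(P : EuclideanSpace ℝ (Fin 4)), (Q : EuclideanSpace ℝ (Fin 4))⟫)

/-- The weight `(1 − ⟨x,P⟩)/(1 + ⟨x,P⟩) = tan²(d(x,P)/2)`, the squared Euclidean norm of the
stereographic coordinate of `x` when `P` is projected to the origin (denoted `|P−P₁|²`
in the paper). -/
def stereoWeight (P x : S3) : ℝ :=
  (1 - ⟪(x : EuclideanSpace ℝ (Fin 4)), (P : EuclideanSpace ℝ (Fin 4))⟫) /
    (1 + ⟪(x : EuclideanSpace ℝ (Fin 4)), (P : EuclideanSpace ℝ (Fin 4))⟫)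


open scoped ENNReal

/-- Integration in polar coordinates of a product of an angular and a radial function. -/
theorem lintegral_angular_mul_radial {E : Type*} [NormedAddCommGroup E] [NormedSpace ℝ E]
    [FiniteDimensional ℝ E] [Nontrivial E] [MeasurableSpace E] [BorelSpace E]
    (μ : Measure E) [μ.IsAddHaarMeasure] {f : E → ℝ≥0∞} (hf : Measurable f)
    {g : ℝ → ℝ≥0∞} (hg : Measurable g) :
    ∫⁻ x, f (‖x‖⁻¹ • x) * g ‖x‖ ∂μ =
      (∫⁻ x : sphere (0 : E) 1, f x ∂μ.toSphere) *
        ∫⁻ r in Ioi (0 : ℝ), ENNReal.ofReal (r ^ (Module.finrank ℝ E - 1)) * g r := by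
  calc
    ∫⁻ x, f (‖x‖⁻¹ • x) * g ‖x‖ ∂μ
        = ∫⁻ x : ({(0 : E)}ᶜ : Set E), f (‖x.1‖⁻¹ • x.1) * g ‖x.1‖ ∂(μ.comap (↑)) := by
      rw [lintegral_subtype_comap (measurableSet_singleton _).compl
        (fun x ↦ f (‖x‖⁻¹ • x) * g ‖x‖), restrict_compl_singleton]
    _ = ∫⁻ p : sphere (0 : E) 1 × Ioi (0 : ℝ), f p.1 * g p.2
          ∂(μ.toSphere.prod (.volumeIoiPow (Module.finrank ℝ E - 1))) := by
      rw [← μ.measurePreserving_homeomorphUnitSphereProd.lintegral_comp_emb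
        (Homeomorph.measurableEmbedding _)]
      simp
    _ = _ := by
      rw [lintegral_prod_mul (f := fun x : sphere (0 : E) 1 ↦ f x)
        (g := fun r : Ioi (0 : ℝ) ↦ g r) (hf.comp measurable_subtype_coe).aemeasurable
        (hg.comp measurable_subtype_coe).aemeasurable]
      congr 1
      rw [Measure.volumeIoiPow, lintegral_withDensity_eq_lintegral_mul₀
        (g := fun r : Ioi (0 : ℝ) ↦ g r) (by fun_prop)
        (hg.comp measurable_subtype_coe).aemeasurable]
      exact lintegral_subtype_comap measurableSet_Ioi
        (fun r ↦ ENNReal.ofReal (r ^ (Module.finrank ℝ E - 1)) * g r)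

theorem lintegral_radial_three {g : ℝ → ℝ≥0∞} (hg : Measurable g) :
    ∫⁻ y : EuclideanSpace ℝ (Fin 3), g ‖y‖ =
      ENNReal.ofReal (4 * π) * ∫⁻ r in Ioi (0 : ℝ), ENNReal.ofReal (r ^ 2) * g r := by
  have h := lintegral_angular_mul_radial (volume : Measure (EuclideanSpace ℝ (Fin 3)))
    (f := fun _ ↦ 1) measurable_const hg
  simp only [one_mul, lintegral_const, Measure.toSphere_apply_univ,
    EuclideanSpace.volume_ball_fin_three, finrank_euclideanSpace_fin] at h
  rw [h]
  congr 1
  rw [ENNReal.ofReal_one, one_pow, one_mul, Nat.cast_ofNat, ← ENNReal.ofReal_ofNat 3,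
    ← ENNReal.ofReal_mul (by norm_num)]
  congr 1
  ring

/-- Fubini for a function depending on one coordinate and on the norm. -/
theorem lintegral_inner_norm (P : S3) {F : ℝ → ℝ → ℝ≥0∞} (hF : Measurable (Function.uncurry F)) :
    ∫⁻ x : EuclideanSpace ℝ (Fin 4), F ⟪x, (P : EuclideanSpace ℝ (Fin 4))⟫ ‖x‖ =
      ∫⁻ a : ℝ, ∫⁻ y : EuclideanSpace ℝ (Fin 3), F a √(a ^ 2 + ‖y‖ ^ 2) := by
  have hP : ‖(P : EuclideanSpace ℝ (Fin 4))‖ = 1 := norm_eq_of_mem_sphere P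
  obtain ⟨b, hb⟩ := Orthonormal.exists_orthonormalBasis_extension_of_card_eq (𝕜 := ℝ)
    (E := EuclideanSpace ℝ (Fin 4)) (ι := Fin 4) (by simp)
    (v := fun _ ↦ (P : EuclideanSpace ℝ (Fin 4))) (s := {0})
    ⟨fun i ↦ by simp [hP], fun i j hij ↦ (hij (Subsingleton.elim i j)).elim⟩
  have hb0 : b 0 = P := hb 0 rfl
  have hinner (x : EuclideanSpace ℝ (Fin 4)) :
      ⟪x, (P : EuclideanSpace ℝ (Fin 4))⟫ = b.repr x 0 := by
    rw [b.repr_apply_apply, hb0, real_inner_comm]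
  have hnorm (x : EuclideanSpace ℝ (Fin 4)) : ‖x‖ = ‖b.repr x‖ := (b.repr.norm_map x).symm
  have hmeas : Measurable fun z : ℝ × EuclideanSpace ℝ (Fin 3) ↦ F z.1 √(z.1 ^ 2 + ‖z.2‖ ^ 2) :=
    hF.comp (f := fun z : ℝ × EuclideanSpace ℝ (Fin 3) ↦ (z.1, √(z.1 ^ 2 + ‖z.2‖ ^ 2)))
      (by fun_prop)
  have e1 := b.repr.measurePreserving
  have e2 := (PiLp.volume_preserving_ofLp (Fin 4))
  have e3 := volume_preserving_piFinSuccAbove (fun _ : Fin 4 ↦ ℝ) 0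
  have e4 := (MeasurePreserving.id (volume : Measure ℝ)).prod (PiLp.volume_preserving_toLp (Fin 3))
  have e := e4.comp (e3.comp (e2.comp e1))
  have key := e.lintegral_comp hmeas
  rw [← lintegral_prod _ hmeas.aemeasurable]
  refine Eq.trans ?_ key
  refine lintegral_congr fun x ↦ ?_
  rw [hinner, hnorm, EuclideanSpace.norm_eq]
  simp only [Function.comp_apply, EuclideanSpace.norm_eq, Fin.sum_univ_succ,
    MeasurableEquiv.piFinSuccAbove_apply]
  rw [sq_sqrt (by positivity)]
  simp [Fin.insertNthEquiv, Fin.tail]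

theorem setLIntegral_Ioi_pow_three_indicator :
    ∫⁻ r in Ioi (0 : ℝ), ENNReal.ofReal (r ^ 3) * (Iio (1 : ℝ)).indicator 1 r ≠ 0 ∧
    ∫⁻ r in Ioi (0 : ℝ), ENNReal.ofReal (r ^ 3) * (Iio (1 : ℝ)).indicator 1 r ≠ ∞ := by
  have h : ∫⁻ r in Ioi (0 : ℝ), ENNReal.ofReal (r ^ 3) * (Iio (1 : ℝ)).indicator 1 r =
      Measure.volumeIoiPow 3 (Iio ⟨1, mem_Ioi.2 one_pos⟩) := by
    rw [Measure.volumeIoiPow, withDensity_apply _ measurableSet_Iio,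
      setLIntegral_subtype measurableSet_Ioi _ fun a : ℝ ↦ .ofReal (a ^ 3),
      image_subtype_val_Ioi_Iio, ← Iio_inter_Ioi, ← setLIntegral_indicator measurableSet_Iio]
    refine lintegral_congr fun r ↦ ?_
    by_cases hr : r ∈ Iio (1 : ℝ) <;> simp [hr]
  rw [h, Measure.volumeIoiPow_apply_Iio]
  norm_num

/-- The slicing formula for zonal functions on `S³`. -/
theorem lintegral_zonal (P : S3) {φ : ℝ → ℝ≥0∞} (hφ : Measurable φ) :
    ∫⁻ x : S3, φ ⟪(x : EuclideanSpace ℝ (Fin 4)), (P : EuclideanSpace ℝ (Fin 4))⟫ ∂μS3 =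
      ENNReal.ofReal (4 * π) *
        ∫⁻ θ in Ioo 0 π, ENNReal.ofReal (sin θ ^ 2) * φ (cos θ) := by
  set g : ℝ → ℝ≥0∞ := (Iio (1 : ℝ)).indicator 1
  have hgm : Measurable g := measurable_one.indicator measurableSet_Iio
  obtain ⟨hK0, hKt⟩ := setLIntegral_Ioi_pow_three_indicator
  have h1 := lintegral_angular_mul_radial (volume : Measure (EuclideanSpace ℝ (Fin 4)))
    (f := fun x ↦ φ ⟪x, (P : EuclideanSpace ℝ (Fin 4))⟫) (hφ.comp (by fun_prop)) hgm
  simp only [finrank_euclideanSpace_fin, Nat.add_one_sub_one] at h1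
  have hF : Measurable (Function.uncurry fun a r : ℝ ↦ φ (r⁻¹ * a) * g r) :=
    (hφ.comp (by fun_prop)).mul (hgm.comp measurable_snd)
  have h2 := lintegral_inner_norm P hF
  simp only [real_inner_smul_left] at h1
  rw [h1] at h2
  set H : ℝ × ℝ → ℝ≥0∞ := fun p ↦ (Ioi (0 : ℝ)).indicator (fun ρ ↦ ENNReal.ofReal (ρ ^ 2) *
    (φ ((√(p.1 ^ 2 + ρ ^ 2))⁻¹ * p.1) * g √(p.1 ^ 2 + ρ ^ 2))) p.2 with hH
  have hHm : Measurable H := by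
    have : H = (univ ×ˢ Ioi (0 : ℝ)).indicator (fun p : ℝ × ℝ ↦ ENNReal.ofReal (p.2 ^ 2) *
      (φ ((√(p.1 ^ 2 + p.2 ^ 2))⁻¹ * p.1) * g √(p.1 ^ 2 + p.2 ^ 2))) := by
      ext p; simp [hH, indicator]
    rw [this]
    refine Measurable.indicator ?_ (MeasurableSet.univ.prod measurableSet_Ioi)
    refine Measurable.mul (by fun_prop) ((hφ.comp (by fun_prop)).mul (hgm.comp (by fun_prop)))
  have h3 (a : ℝ) : ∫⁻ y : EuclideanSpace ℝ (Fin 3),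
      φ ((√(a ^ 2 + ‖y‖ ^ 2))⁻¹ * a) * g √(a ^ 2 + ‖y‖ ^ 2) =
      ENNReal.ofReal (4 * π) * ∫⁻ ρ, H (a, ρ) := by
    rw [lintegral_radial_three (g := fun ρ ↦ φ ((√(a ^ 2 + ρ ^ 2))⁻¹ * a) * g √(a ^ 2 + ρ ^ 2))
      ((hφ.comp (by fun_prop)).mul (hgm.comp (by fun_prop))), ← lintegral_indicator
      measurableSet_Ioi]
  simp only [h3] at h2
  rw [lintegral_const_mul _ hHm.lintegral_prod_right', ← lintegral_prod _ hHm.aemeasurable,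
    ← Measure.volume_eq_prod, ← lintegral_comp_polarCoord_symm] at h2
  have h4 : ∫⁻ p in polarCoord.target, ENNReal.ofReal p.1 • H (polarCoord.symm p) =
      (∫⁻ r in Ioi (0 : ℝ), ENNReal.ofReal (r ^ 3) * g r) *
        ∫⁻ θ in Ioo 0 π, ENNReal.ofReal (sin θ ^ 2) * φ (cos θ) := by
    have hsub : Ioo 0 π = Ioo 0 π ∩ Ioo (-π) π := by
      rw [inter_eq_left.2 (Ioo_subset_Ioo_left (by linarith [pi_pos]))]
    rw [hsub, ← setLIntegral_indicator measurableSet_Ioo, ← lintegral_prod_mul,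
      Measure.prod_restrict, polarCoord_target, Measure.volume_eq_prod]
    · refine setLIntegral_congr_fun (measurableSet_Ioi.prod measurableSet_Ioo) fun p hp ↦ ?_
      obtain ⟨hr, hθ⟩ := hp
      have hr : 0 < p.1 := hr
      have hs : √((p.1 * cos p.2) ^ 2 + (p.1 * sin p.2) ^ 2) = p.1 := by
        rw [mul_pow, mul_pow, ← mul_add, cos_sq_add_sin_sq, mul_one, sqrt_sq hr.le]
      have hiff : p.1 * sin p.2 ∈ Ioi (0 : ℝ) ↔ p.2 ∈ Ioo 0 π := by
        rw [mem_Ioi, mul_pos_iff_of_pos_left hr]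
        refine ⟨fun h ↦ ⟨?_, hθ.2⟩, fun h ↦ sin_pos_of_mem_Ioo h⟩
        by_contra! hc
        exact (sin_nonpos_of_nonpos_of_neg_pi_le hc hθ.1.le).not_gt h
      simp only [hH, polarCoord_symm_apply, smul_eq_mul]
      by_cases h : p.2 ∈ Ioo 0 π
      · rw [indicator_of_mem h, indicator_of_mem (hiff.2 h), hs, inv_mul_cancel_left₀ hr.ne',
          mul_pow, ENNReal.ofReal_mul (by positivity), pow_succ p.1 2,
          ENNReal.ofReal_mul (by positivity)]
        ring
      · rw [indicator_of_notMem h, indicator_of_notMem (mt hiff.1 h)]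
        simp
    · exact ((by fun_prop : Measurable fun r : ℝ ↦ ENNReal.ofReal (r ^ 3)).mul hgm).aemeasurable
    · exact ((Measurable.mul (by fun_prop) (hφ.comp (by fun_prop))).indicator
        measurableSet_Ioo).aemeasurable
  rw [h4, mul_left_comm, mul_comm (∫⁻ x : S3, _ ∂_)] at h2
  exact (ENNReal.mul_right_inj hK0 hKt).1 h2

theorem bubble_denom_pos {s c : ℝ} (hs : 0 < s) (hc : c ∈ Icc (-1) 1) :
    0 < 1 + ((s ^ 2 - 1) / 2) * (1 - c) := by
  obtain ⟨h1, h2⟩ := hc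
  have : 0 < s ^ 2 := by positivity
  rcases h1.eq_or_lt with rfl | h1
  · linarith
  · nlinarith [mul_nonneg this.le (sub_nonneg.2 h2)]

/-- The primitive, in terms of `u = s tan (θ / 2)`, of the zonal integrand. -/
theorem hasDerivAt_arctan_sub_rational (u : ℝ) :
    HasDerivAt (fun u : ℝ ↦ 3 * arctan u - (5 * u ^ 3 + 3 * u) / (1 + u ^ 2) ^ 2)
      (8 * u ^ 4 / (1 + u ^ 2) ^ 3) u := by
  have hpos : (1 + u ^ 2) ≠ 0 := by positivity
  have h1 := (hasDerivAt_arctan u).const_mul 3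
  have h2 : HasDerivAt (fun u : ℝ ↦ 5 * u ^ 3 + 3 * u) (15 * u ^ 2 + 3) u := by
    convert! (((hasDerivAt_id u).pow 3).const_mul 5).add ((hasDerivAt_id u).const_mul 3) using 1
    simp; ring
  have h3 : HasDerivAt (fun u : ℝ ↦ (1 + u ^ 2) ^ 2) (4 * u * (1 + u ^ 2)) u := by
    convert! (((hasDerivAt_id u).pow 2).const_add 1).pow 2 using 1
    simp; ring
  convert! h1.sub (h2.div h3 (by positivity)) using 1
  field_simp
  ring

theorem tendsto_arctan_sub_rational_atTop :
    Filter.Tendsto (fun u : ℝ ↦ 3 * arctan u - (5 * u ^ 3 + 3 * u) / (1 + u ^ 2) ^ 2)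
      Filter.atTop (nhds (3 * (π / 2))) := by
  have h1 : Filter.Tendsto arctan Filter.atTop (nhds (π / 2)) :=
    tendsto_arctan_atTop.mono_right nhdsWithin_le_nhds
  have h2 : Filter.Tendsto (fun u : ℝ ↦ (5 * u ^ 3 + 3 * u) / (1 + u ^ 2) ^ 2)
      Filter.atTop (nhds 0) := by
    refine squeeze_zero' ?_ ?_ ((tendsto_const_nhds (x := (5 : ℝ))).div_atTop Filter.tendsto_id)
    · filter_upwards [Filter.eventually_ge_atTop 0] with u hu
      positivity
    · filter_upwards [Filter.eventually_gt_atTop 0] with u hu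
      rw [id, div_le_div_iff₀ (by positivity) hu]
      nlinarith [sq_nonneg u]
  simpa using (h1.const_mul 3).sub h2

theorem integral_zonal_bubble {s : ℝ} (hs : 0 < s) :
    ∫ θ in (0)..π, (1 - cos θ) ^ 2 * (s / (1 + ((s ^ 2 - 1) / 2) * (1 - cos θ))) ^ 3 =
      3 * π / 2 / s ^ 2 := by
  have hc (θ : ℝ) : cos θ ∈ Icc (-1) 1 := ⟨neg_one_le_cos θ, cos_le_one θ⟩
  have hcont : Continuous fun θ : ℝ ↦
      (1 - cos θ) ^ 2 * (s / (1 + ((s ^ 2 - 1) / 2) * (1 - cos θ))) ^ 3 := by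
    refine Continuous.mul (by fun_prop) (.pow (.div₀ (by fun_prop) (by fun_prop) fun θ ↦ ?_) 3)
    exact (bubble_denom_pos hs (hc θ)).ne'
  have hhalf : Continuous fun θ : ℝ ↦ θ / 2 := by fun_prop
  have key := intervalIntegral.integral_eq_sub_of_hasDerivAt_of_tendsto (a := 0) (b := π)
    (f := fun θ ↦ (3 * arctan (s * tan (θ / 2)) - (5 * (s * tan (θ / 2)) ^ 3 +
      3 * (s * tan (θ / 2))) / (1 + (s * tan (θ / 2)) ^ 2) ^ 2) / s ^ 2)
    (fa := 0) (fb := 3 * (π / 2) / s ^ 2) pi_pos (fun θ hθ ↦ ?_)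
    (hcont.intervalIntegrable 0 π) ?_ ?_
  · rw [key]; ring
  · have hx : 0 < cos (θ / 2) :=
      cos_pos_of_mem_Ioo ⟨by linarith [hθ.1, pi_pos], by linarith [hθ.2]⟩
    have h1 := (((hasDerivAt_tan hx.ne').comp θ ((hasDerivAt_id θ).div_const 2)).const_mul s)
    have h2 := ((hasDerivAt_arctan_sub_rational (s * tan (θ / 2))).comp θ h1).div_const (s ^ 2)
    convert! h2 using 1
    have hcos : cos θ = 2 * cos (θ / 2) ^ 2 - 1 := by
      rw [← cos_two_mul, mul_div_cancel₀ θ two_ne_zero]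
    have hD := bubble_denom_pos hs (hc θ)
    have hu : 0 < 1 + (s * tan (θ / 2)) ^ 2 := by positivity
    have hT : tan (θ / 2) ^ 2 * cos (θ / 2) ^ 2 = 1 - cos (θ / 2) ^ 2 := by
      rw [← mul_pow, tan_mul_cos hx.ne', sin_sq]
    have hv : 1 - cos θ = 2 * (tan (θ / 2) ^ 2 * cos (θ / 2) ^ 2) := by rw [hT, hcos]; ring
    have hDu : 1 + ((s ^ 2 - 1) / 2) * (1 - cos θ) =
        cos (θ / 2) ^ 2 * (1 + (s * tan (θ / 2)) ^ 2) := by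
      rw [hv]; linear_combination (-1 : ℝ) * hT
    rw [hDu, hv]
    field_simp
    ring
  · have : ContinuousAt (fun θ ↦ (3 * arctan (s * tan (θ / 2)) - (5 * (s * tan (θ / 2)) ^ 3 +
      3 * (s * tan (θ / 2))) / (1 + (s * tan (θ / 2)) ^ 2) ^ 2) / s ^ 2) 0 := by
      have ht : ContinuousAt (fun θ : ℝ ↦ s * tan (θ / 2)) 0 :=
        continuousAt_const.mul ((continuousAt_tan.2 (by simp)).comp hhalf.continuousAt)
      exact ((hasDerivAt_arctan_sub_rational _).continuousAt.comp ht).div_const _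
    simpa using this.tendsto.mono_left nhdsWithin_le_nhds
  · refine (tendsto_arctan_sub_rational_atTop.comp
      (Filter.Tendsto.const_mul_atTop hs (tendsto_tan_pi_div_two.comp ?_))).div_const _
    refine tendsto_nhdsWithin_iff.2 ⟨(hhalf.tendsto π).mono_left nhdsWithin_le_nhds, ?_⟩
    filter_upwards [self_mem_nhdsWithin] with θ hθ
    exact div_lt_div_of_pos_right (mem_Iio.1 hθ) (two_pos (α := ℝ))

theorem inner_mem_Icc (x P : S3) :
    ⟪(x : EuclideanSpace ℝ (Fin 4)), (P : EuclideanSpace ℝ (Fin 4))⟫ ∈ Icc (-1 : ℝ) 1 := by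
  refine abs_le.1 ?_
  simpa using abs_real_inner_le_norm (x : EuclideanSpace ℝ (Fin 4)) P

theorem stereoWeight_nonneg (P x : S3) : 0 ≤ stereoWeight P x := by
  obtain ⟨h1, h2⟩ := inner_mem_Icc x P
  exact div_nonneg (by linarith) (by linarith)

theorem bubble_pos (P x : S3) {s : ℝ} (hs : 0 < s) : 0 < bubble P s x :=
  div_pos hs (bubble_denom_pos hs (inner_mem_Icc x P))

theorem measurable_stereoWeight (P : S3) : Measurable (stereoWeight P) := by
  unfold stereoWeight; fun_prop

theorem measurable_bubble (P : S3) (s : ℝ) : Measurable (bubble P s) := by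
  unfold bubble; fun_prop

theorem lintegral_stereoWeight_mul_bubble_cube (P : S3) {s : ℝ} (hs : 0 < s) :
    ∫⁻ x, ENNReal.ofReal (stereoWeight P x * bubble P s x ^ 3) ∂μS3 =
      ENNReal.ofReal (6 * π ^ 2 / s ^ 2) := by
  have h := lintegral_zonal P (φ := fun c ↦ ENNReal.ofReal ((1 - c) / (1 + c) *
    (s / (1 + ((s ^ 2 - 1) / 2) * (1 - c))) ^ 3)) (by fun_prop)
  have hc (θ : ℝ) : cos θ ∈ Icc (-1) 1 := ⟨neg_one_le_cos θ, cos_le_one θ⟩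
  have hnn (θ : ℝ) : 0 ≤ (1 - cos θ) ^ 2 * (s / (1 + ((s ^ 2 - 1) / 2) * (1 - cos θ))) ^ 3 :=
    mul_nonneg (sq_nonneg _) (pow_nonneg (div_pos hs (bubble_denom_pos hs (hc θ))).le 3)
  have hcont : Continuous fun θ : ℝ ↦
      (1 - cos θ) ^ 2 * (s / (1 + ((s ^ 2 - 1) / 2) * (1 - cos θ))) ^ 3 := by
    refine Continuous.mul (by fun_prop) (.pow (.div₀ (by fun_prop) (by fun_prop) fun θ ↦ ?_) 3)
    exact (bubble_denom_pos hs (hc θ)).ne'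
  refine h.trans ?_
  have h2 : ∫⁻ θ in Ioo 0 π, ENNReal.ofReal (sin θ ^ 2) * ENNReal.ofReal ((1 - cos θ) /
      (1 + cos θ) * (s / (1 + ((s ^ 2 - 1) / 2) * (1 - cos θ))) ^ 3) =
      ENNReal.ofReal (3 * π / 2 / s ^ 2) := by
    rw [← integral_zonal_bubble hs, intervalIntegral.integral_of_le pi_pos.le,
      ofReal_integral_eq_lintegral_ofReal (hcont.integrableOn_Ioc) (.of_forall hnn),
      ← restrict_Ioo_eq_restrict_Ioc]
    refine setLIntegral_congr_fun measurableSet_Ioo fun θ hθ ↦ ?_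
    have h1 : 1 + cos θ ≠ 0 := by
      have := cos_lt_cos_of_nonneg_of_le_pi hθ.1.le le_rfl hθ.2
      rw [cos_pi] at this; linarith
    rw [← ENNReal.ofReal_mul (sq_nonneg _), ← mul_assoc]
    congr 2
    rw [sin_sq]
    field_simp
    ring
  rw [h2, ← ENNReal.ofReal_mul (by positivity)]
  congr 1
  ring

theorem integrable_stereoWeight_mul_bubble_cube (P : S3) {s : ℝ} (hs : 0 < s) :
    Integrable (fun x ↦ stereoWeight P x * bubble P s x ^ 3) μS3 := by
  refine ⟨((measurable_stereoWeight P).mul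
    ((measurable_bubble P s).pow_const 3)).aestronglyMeasurable, ?_⟩
  rw [hasFiniteIntegral_iff_ofReal (.of_forall fun x ↦
    mul_nonneg (stereoWeight_nonneg P x) (pow_nonneg (bubble_pos P x hs).le 3)),
    lintegral_stereoWeight_mul_bubble_cube P hs]
  exact ENNReal.ofReal_lt_top

theorem integral_stereoWeight_mul_bubble_cube (P : S3) {s : ℝ} (hs : 0 < s) :
    ∫ x, stereoWeight P x * bubble P s x ^ 3 ∂μS3 = 6 * π ^ 2 / s ^ 2 := by
  rw [integral_eq_lintegral_of_nonneg_ae (.of_forall fun x ↦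
    mul_nonneg (stereoWeight_nonneg P x) (pow_nonneg (bubble_pos P x hs).le 3))
    (integrable_stereoWeight_mul_bubble_cube P hs).aestronglyMeasurable,
    lintegral_stereoWeight_mul_bubble_cube P hs, ENNReal.toReal_ofReal (by positivity)]

theorem integrable_stereoWeight (P : S3) : Integrable (stereoWeight P) μS3 := by
  simpa [bubble] using integrable_stereoWeight_mul_bubble_cube P one_pos

/-- The derivative of `s ↦ bubble P s x`. -/
def bubbleDeriv (P : S3) (s : ℝ) (x : S3) : ℝ :=
  (1 - ((s ^ 2 + 1) / 2) *
    (1 - ⟪(x : EuclideanSpace ℝ (Fin 4)), (P : EuclideanSpace ℝ (Fin 4))⟫)) /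
  (1 + ((s ^ 2 - 1) / 2) *
    (1 - ⟪(x : EuclideanSpace ℝ (Fin 4)), (P : EuclideanSpace ℝ (Fin 4))⟫)) ^ 2

theorem measurable_bubbleDeriv (P : S3) (s : ℝ) : Measurable (bubbleDeriv P s) := by
  unfold bubbleDeriv; fun_prop

theorem hasDerivAt_bubble (P x : S3) {s : ℝ} (hs : 0 < s) :
    HasDerivAt (fun s ↦ bubble P s x) (bubbleDeriv P s x) s := by
  unfold bubble bubbleDeriv
  have hD := bubble_denom_pos hs (inner_mem_Icc x P)
  set v := 1 - ⟪(x : EuclideanSpace ℝ (Fin 4)), (P : EuclideanSpace ℝ (Fin 4))⟫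
  have h : HasDerivAt (fun s : ℝ ↦ 1 + ((s ^ 2 - 1) / 2) * v) (s * v) s := by
    convert! (((((hasDerivAt_id s).pow 2).sub_const 1).div_const 2).mul_const v).const_add 1
      using 1
    simp
  convert! (hasDerivAt_id s).div h hD.ne' using 1
  simp only [id]
  ring

theorem abs_bubbleDeriv_le (P x : S3) {s : ℝ} (hs : 0 < s) :
    |bubbleDeriv P s x| ≤ bubble P s x / s := by
  unfold bubble bubbleDeriv
  have hc := inner_mem_Icc x P
  have hD := bubble_denom_pos hs hc
  set c := ⟪(x : EuclideanSpace ℝ (Fin 4)), (P : EuclideanSpace ℝ (Fin 4))⟫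
  have h2 : 0 ≤ s ^ 2 * (1 - c) := mul_nonneg (sq_nonneg s) (by linarith [hc.2])
  rw [abs_div, abs_of_pos (pow_pos hD 2), div_right_comm, div_self hs.ne',
    div_le_div_iff₀ (pow_pos hD 2) hD, one_mul,
    sq (1 + ((s ^ 2 - 1) / 2) * (1 - c))]
  refine mul_le_mul_of_nonneg_right ?_ hD.le
  rw [abs_le]
  constructor <;> linarith [hc.1, hc.2]

theorem bubble_le (P x : S3) {s : ℝ} (hs : 1 ≤ s) : bubble P s x ≤ s := by
  have hc := inner_mem_Icc x P
  refine div_le_self (by linarith) ?_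
  have : 0 ≤ (s ^ 2 - 1) / 2 := by nlinarith
  nlinarith [mul_nonneg this (sub_nonneg.2 hc.2)]

theorem inv_le_bubble (P x : S3) {s : ℝ} (hs : 1 ≤ s) : s⁻¹ ≤ bubble P s x := by
  have hc := inner_mem_Icc x P
  have hs0 : 0 < s := by linarith
  rw [bubble, inv_eq_one_div, div_le_div_iff₀ hs0 (bubble_denom_pos hs0 hc)]
  have : 0 ≤ (s ^ 2 - 1) / 2 := by nlinarith
  nlinarith [mul_nonneg this (by linarith [hc.1] : 0 ≤
    1 + ⟪(x : EuclideanSpace ℝ (Fin 4)), (P : EuclideanSpace ℝ (Fin 4))⟫)]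

theorem abs_log_bubble_le (P x : S3) {s : ℝ} (hs : 1 ≤ s) : |log (bubble P s x)| ≤ log s := by
  have hs0 : 0 < s := by linarith
  rw [abs_le, ← log_inv]
  exact ⟨log_le_log (inv_pos.2 hs0) (inv_le_bubble P x hs),
    log_le_log (bubble_pos P x hs0) (bubble_le P x hs)⟩

/-- Differentiation under the integral sign. -/
theorem hasDerivAt_integral_stereoWeight_mul_bubble_rpow (P : S3) {s p : ℝ} (hs : 1 < s)
    (hp : 0 ≤ p) :
    Integrable (fun x ↦ stereoWeight P x * (bubbleDeriv P s x * p * bubble P s x ^ (p - 1))) μS3 ∧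
    HasDerivAt (fun s ↦ ∫ x, stereoWeight P x * bubble P s x ^ p ∂μS3)
      (∫ x, stereoWeight P x * (bubbleDeriv P s x * p * bubble P s x ^ (p - 1)) ∂μS3) s := by
  have hmeas (q : ℝ) : AEStronglyMeasurable (fun x ↦ stereoWeight P x * bubble P q x ^ p) μS3 :=
    ((measurable_stereoWeight P).mul ((measurable_bubble P q).pow_const p)).aestronglyMeasurable
  have hbound (q : ℝ) (hq : q ∈ Ioo 1 (s + 1)) (x : S3) : bubble P q x ^ p ≤ (s + 1) ^ p :=
    rpow_le_rpow (bubble_pos P x (by linarith [hq.1])).le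
      ((bubble_le P x hq.1.le).trans hq.2.le) hp
  refine hasDerivAt_integral_of_dominated_loc_of_deriv_le (μ := μS3)
    (s := Ioo 1 (s + 1)) (bound := fun x ↦ stereoWeight P x * (p * (s + 1) ^ p))
    (F' := fun s x ↦ stereoWeight P x * (bubbleDeriv P s x * p * bubble P s x ^ (p - 1)))
    (Ioo_mem_nhds hs (by linarith)) (.of_forall hmeas) ?_ ?_ ?_ ?_ ?_
  · refine ((integrable_stereoWeight P).mul_const ((s + 1) ^ p)).mono' (hmeas s) ?_
    refine .of_forall fun x ↦ ?_
    rw [norm_of_nonneg (mul_nonneg (stereoWeight_nonneg P x)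
      (rpow_nonneg (bubble_pos P x (by linarith)).le p))]
    exact mul_le_mul_of_nonneg_left (hbound s ⟨hs, by linarith⟩ x) (stereoWeight_nonneg P x)
  · exact ((measurable_stereoWeight P).mul (((measurable_bubbleDeriv P s).mul_const p).mul
      ((measurable_bubble P s).pow_const (p - 1)))).aestronglyMeasurable
  · refine .of_forall fun x q hq ↦ ?_
    have hq0 : 0 < q := by linarith [hq.1]
    have hb := bubble_pos P x hq0
    have hd : |bubbleDeriv P q x| ≤ bubble P q x :=
      (abs_bubbleDeriv_le P x hq0).trans (div_le_self hb.le hq.1.le)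
    rw [norm_mul, norm_of_nonneg (stereoWeight_nonneg P x), norm_mul, norm_mul,
      norm_of_nonneg hp, norm_of_nonneg (rpow_nonneg hb.le _), norm_eq_abs]
    refine mul_le_mul_of_nonneg_left ?_ (stereoWeight_nonneg P x)
    calc |bubbleDeriv P q x| * p * bubble P q x ^ (p - 1)
        ≤ bubble P q x * p * bubble P q x ^ (p - 1) := by gcongr
      _ = p * bubble P q x ^ p := by rw [rpow_sub_one hb.ne']; field_simp
      _ ≤ p * (s + 1) ^ p := mul_le_mul_of_nonneg_left (hbound q hq x) hp
  · exact (integrable_stereoWeight P).mul_const _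
  · exact .of_forall fun x q hq ↦ ((hasDerivAt_bubble P x (by linarith [hq.1])).rpow_const
      (.inl (bubble_pos P x (by linarith [hq.1])).ne')).const_mul _

theorem integral_deriv_cube (P : S3) {s : ℝ} (hs : 1 < s) :
    ∫ x, stereoWeight P x * (bubbleDeriv P s x * 3 * bubble P s x ^ ((3 : ℝ) - 1)) ∂μS3 =
      -(12 * π ^ 2 / s ^ 3) := by
  have hs0 : 0 < s := by linarith
  have h1 := (hasDerivAt_integral_stereoWeight_mul_bubble_rpow P hs zero_le_three).2
  have h2 : HasDerivAt (fun s : ℝ ↦ 6 * π ^ 2 / s ^ 2) (-(12 * π ^ 2 / s ^ 3)) s := by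
    convert! (((hasDerivAt_id s).pow 2).inv (pow_ne_zero 2 hs0.ne')).const_mul (6 * π ^ 2) using 1
    simp
    field_simp
    ring
  refine h1.unique (h2.congr_of_eventuallyEq ?_)
  filter_upwards [lt_mem_nhds hs0] with q hq
  rw [← integral_stereoWeight_mul_bubble_cube P hq]
  norm_cast

theorem abs_rpow_sub_le {b τ L : ℝ} (hb : 0 < b) (hτ : 0 ≤ τ) (hL : |log b| ≤ L)
    (hτL : τ * L ≤ 1) :
    |(3 - τ) * b ^ (3 - τ - 1) - 3 * b ^ ((3 : ℝ) - 1)| ≤ (6 * (τ * L) + 3 * τ) * b ^ 2 := by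
  have h1 : b ^ (3 - τ - 1) = b ^ (-τ) * b ^ 2 := by
    rw [← rpow_natCast b 2, ← rpow_add hb]; congr 1; push_cast; ring
  have h2 : b ^ ((3 : ℝ) - 1) = b ^ 2 := by rw [← rpow_natCast b 2]; norm_num
  have hx : |log b * -τ| ≤ τ * L := by
    rw [abs_mul, abs_neg, abs_of_nonneg hτ, mul_comm]
    exact mul_le_mul_of_nonneg_left hL hτ
  have h3 : |b ^ (-τ) - 1| ≤ 2 * (τ * L) := by
    rw [rpow_def_of_pos hb]
    exact (abs_exp_sub_one_le (hx.trans hτL)).trans (by linarith)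
  have h4 := abs_le.1 h3
  have h5 := rpow_pos_of_pos hb (-τ)
  rw [h1, h2, show (3 - τ) * (b ^ (-τ) * b ^ 2) - 3 * b ^ 2 =
    (3 * (b ^ (-τ) - 1) - τ * b ^ (-τ)) * b ^ 2 by ring, abs_mul, abs_of_nonneg (sq_nonneg b)]
  refine mul_le_mul_of_nonneg_right ?_ (sq_nonneg b)
  have h6 : τ * b ^ (-τ) ≤ τ * 3 := mul_le_mul_of_nonneg_left (by linarith) hτ
  have h7 := mul_nonneg hτ h5.le
  rw [abs_le]
  constructor <;> linarith [h4.1, h4.2]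

theorem abs_deriv_add_le (P : S3) {s τ : ℝ} (hs : 1 < s) (hτ : 0 ≤ τ) (hτ3 : τ ≤ 3)
    (hlog : τ * log s ≤ 1) :
    |deriv (fun s ↦ ∫ x, stereoWeight P x * bubble P s x ^ ((3 : ℝ) - τ) ∂μS3) s +
      12 * π ^ 2 / s ^ 3| ≤ (6 * (τ * log s) + 3 * τ) * (6 * π ^ 2 / s ^ 3) := by
  have hs0 : 0 < s := by linarith
  obtain ⟨hi1, hd1⟩ := hasDerivAt_integral_stereoWeight_mul_bubble_rpow P hs (sub_nonneg.2 hτ3)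
  obtain ⟨hi2, -⟩ := hasDerivAt_integral_stereoWeight_mul_bubble_rpow P hs zero_le_three
  rw [hd1.deriv, ← sub_neg_eq_add, ← integral_deriv_cube P hs, ← integral_sub hi1 hi2,
    ← norm_eq_abs]
  refine (norm_integral_le_of_norm_le (((integrable_stereoWeight_mul_bubble_cube P hs0).const_mul
    ((6 * (τ * log s) + 3 * τ) / s))) (.of_forall fun x ↦ ?_)).trans_eq ?_
  · have hb := bubble_pos P x hs0
    have hw := stereoWeight_nonneg P x
    have h := abs_rpow_sub_le hb hτ (abs_log_bubble_le P x hs.le) hlog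
    have hd := abs_bubbleDeriv_le P x hs0
    rw [show stereoWeight P x * (bubbleDeriv P s x * (3 - τ) * bubble P s x ^ (3 - τ - 1)) -
      stereoWeight P x * (bubbleDeriv P s x * 3 * bubble P s x ^ ((3 : ℝ) - 1)) =
      stereoWeight P x * (bubbleDeriv P s x * ((3 - τ) * bubble P s x ^ (3 - τ - 1) -
        3 * bubble P s x ^ ((3 : ℝ) - 1))) by ring, norm_mul, norm_mul, norm_of_nonneg hw,
      norm_eq_abs, norm_eq_abs]
    calc _ ≤ stereoWeight P x * (bubble P s x / s *
          ((6 * (τ * log s) + 3 * τ) * bubble P s x ^ 2)) := by gcongr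
      _ = _ := by ring
  · rw [integral_const_mul, integral_stereoWeight_mul_bubble_cube P hs0]
    field_simp

theorem stmt19 (A : ℝ) (hA : 1 ≤ A) :
    ∃ C > 0, ∃ τ₀ ∈ Set.Ioo (0 : ℝ) 1, ∀ τ ∈ Set.Ioo (0 : ℝ) τ₀, ∀ P₁ : S3, ∀ t₁ : ℝ,
      A⁻¹ * τ ^ (-(1 : ℝ) / 2) < t₁ → t₁ < A * τ ^ (-(1 : ℝ) / 2) →
      |deriv (fun s => ∫ x, stereoWeight P₁ x * (bubble P₁ s x) ^ ((3 : ℝ) - τ) ∂μS3) t₁ +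
          12 * π ^ 2 / t₁ ^ 3| ≤ C * τ ^ ((5 : ℝ) / 2) * |Real.log τ| := by
  have hA0 : 0 < A := by linarith
  refine ⟨54 * π ^ 2 * A ^ 3, by positivity, (4 * A ^ 2)⁻¹, ⟨by positivity, ?_⟩, ?_⟩
  · exact inv_lt_one_of_one_lt₀ (by nlinarith)
  rintro τ ⟨hτ, hτ0⟩ P t hlt htl
  set T := τ ^ (-(1 : ℝ) / 2) with hT
  have hT0 : 0 < T := rpow_pos_of_pos hτ _
  have hT2 : T ^ 2 = τ⁻¹ := by
    rw [hT, ← rpow_natCast, ← rpow_mul hτ.le, ← rpow_neg_one]; norm_num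
  have hAT : 2 * A < T := by
    refine lt_of_pow_lt_pow_left₀ 2 hT0.le ?_
    rw [hT2, lt_inv_comm₀ (by positivity) hτ, show (2 * A) ^ 2 = 4 * A ^ 2 by ring]
    exact hτ0
  have ht : 1 < t := by
    refine lt_trans ?_ hlt
    rw [inv_mul_eq_div, one_lt_div hA0]; linarith
  have ht0 : 0 < t := by linarith
  have hlogT : |log τ| = 2 * log T := by
    have h1 : -log τ = 2 * log T := by
      rw [← log_inv, ← hT2, log_pow]; norm_num
    rw [← h1, abs_of_nonpos]
    have := log_nonneg (by linarith : 1 ≤ T)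
    linarith
  have hlogt : log t ≤ |log τ| := by
    rw [hlogT]
    calc log t ≤ log (T * T) := log_le_log ht0 (htl.le.trans (by gcongr; linarith))
      _ = 2 * log T := by rw [log_mul hT0.ne' hT0.ne']; ring
  have hlog1 : 1 ≤ |log τ| := by
    have : (1 : ℝ) / 2 ≤ log 2 := by linarith [log_two_gt_d9]
    have := log_le_log two_pos (by linarith : 2 ≤ T)
    linarith
  have hτlog : τ * |log τ| ≤ 1 := by
    have h1 : |log τ| ≤ τ⁻¹ := by
      rw [hlogT, ← hT2]
      have h2 := log_le_sub_one_of_pos (pow_pos hT0 2)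
      rw [log_pow] at h2
      push_cast at h2
      linarith
    calc τ * |log τ| ≤ τ * τ⁻¹ := by gcongr
      _ = 1 := mul_inv_cancel₀ hτ.ne'
  have hτt : τ * log t ≤ τ * |log τ| := mul_le_mul_of_nonneg_left hlogt hτ.le
  have hτ3 : τ ≤ 3 := by nlinarith
  have hpow : τ ^ ((5 : ℝ) / 2) = τ * (T ^ 3)⁻¹ := by
    rw [hT, ← rpow_natCast, ← rpow_mul hτ.le, ← rpow_neg hτ.le, ← rpow_one_add' hτ.le] <;> norm_num
  have htinv : (t ^ 3)⁻¹ ≤ A ^ 3 * (T ^ 3)⁻¹ := by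
    rw [← inv_inv (A ^ 3), ← mul_inv, ← inv_pow A 3, ← mul_pow]
    gcongr
  calc _ ≤ (6 * (τ * log t) + 3 * τ) * (6 * π ^ 2 / t ^ 3) :=
        abs_deriv_add_le P ht hτ.le hτ3 (hτt.trans hτlog)
    _ ≤ (9 * (τ * |log τ|)) * (6 * π ^ 2 * (A ^ 3 * (T ^ 3)⁻¹)) := by
        rw [div_eq_mul_inv]
        gcongr
        nlinarith
    _ = _ := by rw [hpow]; ring
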